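/- arXiv:1306.4657 — 3 statements merged into one kernel-verified Lean document; each statement's English description precedes it below -/
import Mathlib

section
/- Let k ≥ 1 and let Q be a k×k row-stochastic matrix (transition matrix) that is invertible (full rank), let π be a probability vector on {1,…,k} with πQ = π and π_j > 0 for all j, and let μ_1,…,μ_k be probability measures on ℝ that are linearly independent as elements of the real vector space of finite signed measures on ℝ. Let Q̃ be any k×k row-stochastic matrix, π̃ a probability vector with π̃Q̃ = π̃, and μ̃_1,…,μ̃_k any probability measures on ℝ. If the two measures on ℝ³ given by Σ_{i=1}^k (Σ_{j=1}^k π_j Q_{j,i} μ_j) ⊗ μ_i ⊗ (Σ_{j=1}^k Q_{i,j} μ_j) and Σ_{i=1}^k (Σ_{j=1}^k π̃_j Q̃_{j,i} μ̃_j) ⊗ μ̃_i ⊗ (Σ_{j=1}^k Q̃_{i,j} μ̃_j) are equal, then there exists a permutation σ of {1,…,k} such that for all i, j: μ̃_i = μ_{σ(i)}, Q̃_{i,j} = Q_{σ(i),σ(j)}, and π̃_i = π_{σ(i)}. -/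
open MeasureTheory Finset

/-- A linearly independent family over a field has a dual family of linear functionals. -/
theorem LinearIndependent.exists_dual_family {K V ι : Type*} [Field K] [AddCommGroup V]
    [Module K V] [DecidableEq ι] {v : ι → V} (hv : LinearIndependent K v) :
    ∃ φ : ι → V →ₗ[K] K, ∀ j i, φ j (v i) = if i = j then 1 else 0 := by
  choose φ hφ using fun j => LinearMap.exists_extend (Finsupp.lapply j ∘ₗ hv.repr)
  refine ⟨φ, fun j i => ?_⟩
  have hi : v i ∈ Submodule.span K (Set.range v) := Submodule.subset_span ⟨i, rfl⟩
  have := LinearMap.congr_fun (hφ j) ⟨v i, hi⟩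
  simpa [hv.repr_eq_single i ⟨v i, hi⟩ rfl, Finsupp.single_apply] using this

/-- An invertible matrix carries a linearly independent family to a linearly independent family. -/
theorem LinearIndependent.sum_smul_of_det_ne_zero {K V ι : Type*} [Field K] [AddCommGroup V]
    [Module K V] [Fintype ι] [DecidableEq ι] {v : ι → V} (hv : LinearIndependent K v)
    {M : Matrix ι ι K} (hM : M.det ≠ 0) :
    LinearIndependent K fun i => ∑ j, M i j • v j := by
  rw [Fintype.linearIndependent_iff] at hv ⊢
  intro g hg
  refine congrFun (Matrix.eq_zero_of_vecMul_eq_zero hM (funext fun j => ?_))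
  refine hv (fun j => ∑ i, g i * M i j) ?_ j
  simp_rw [smul_sum, smul_smul] at hg
  rw [sum_comm] at hg
  simpa only [sum_smul] using hg

/-- Applying linear functionals to the outer factors of an equality of sums of threefold products
of functions. -/
theorem sum_mul_functional_eq {K X ι : Type*} [Field K] [Fintype ι]
    {a b c a' b' c' : ι → X → K}
    (h : ∀ x y z, ∑ i, a i x * b i y * c i z = ∑ i, a' i x * b' i y * c' i z)
    (φ ψ : (X → K) →ₗ[K] K) (y : X) :
    ∑ i, φ (a i) * b i y * ψ (c i) = ∑ i, φ (a' i) * b' i y * ψ (c' i) := by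
  have h₁ (z : X) : ∑ i, φ (a i) * b i y * c i z = ∑ i, φ (a' i) * b' i y * c' i z := by
    have : ∑ i, (b i y * c i z) • a i = ∑ i, (b' i y * c' i z) • a' i := by
      ext x
      simpa [Finset.sum_apply, mul_assoc, mul_comm, mul_left_comm] using h x y z
    simpa [map_sum, mul_assoc, mul_comm, mul_left_comm] using congrArg φ this
  have h₂ : ∑ i, (φ (a i) * b i y) • c i = ∑ i, (φ (a' i) * b' i y) • c' i := by
    ext z
    simpa [Finset.sum_apply] using h₁ z
  simpa [map_sum] using congrArg ψ h₂

/-- If the outer factors of a sum of threefold products are linearly independent and the middle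
factors are distinct and normalized at a point, then the middle factors are determined up to a
permutation. -/
theorem exists_perm_middle_factor_eq {K X ι : Type*} [Field K] [Fintype ι] [DecidableEq ι]
    {a b c a' b' c' : ι → X → K}
    (ha : LinearIndependent K a) (hb : Function.Injective b) (hc : LinearIndependent K c)
    {u : X} (hbu : ∀ i, b i u = 1) (hbu' : ∀ i, b' i u = 1)
    (h : ∀ x y z, ∑ i, a i x * b i y * c i z = ∑ i, a' i x * b' i y * c' i z) :
    ∃ σ : Equiv.Perm ι, ∀ i, b' i = b (σ i) := by
  obtain ⟨φ, hφ⟩ := ha.exists_dual_family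
  obtain ⟨ψ, hψ⟩ := hc.exists_dual_family
  let A : Matrix ι ι K := .of fun j i => φ j (a' i)
  let C : Matrix ι ι K := .of fun i l => ψ l (c' i)
  have key (y : X) : Matrix.diagonal (fun i => b i y) =
      A * Matrix.diagonal (fun i => b' i y) * C := by
    ext j l
    have := sum_mul_functional_eq h (φ j) (ψ l) y
    simp only [hφ, hψ, ite_mul, one_mul, zero_mul, sum_ite_eq', mem_univ, if_true] at this
    simpa [Matrix.mul_apply, Matrix.mul_diagonal, Matrix.diagonal_apply, A, C] using this
  have hAC : A * C = 1 := by simpa [hbu, hbu'] using (key u).symm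
  have hCA : C * A = 1 := mul_eq_one_comm.mp hAC
  have hcomm (j i : ι) (hji : A j i ≠ 0) : b' i = b j := by
    ext y
    have h₁ : Matrix.diagonal (fun i => b i y) * A = A * Matrix.diagonal (fun i => b' i y) := by
      rw [key y, Matrix.mul_assoc, hCA, Matrix.mul_one]
    have h₂ := congrFun (congrFun h₁ j) i
    rw [Matrix.diagonal_mul, Matrix.mul_diagonal, mul_comm] at h₂
    exact (mul_left_cancel₀ hji h₂).symm
  have hcol (i : ι) : ∃ j, A j i ≠ 0 := by
    by_contra! h₀
    have := congrFun (congrFun hCA i) i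
    simp [Matrix.mul_apply, h₀] at this
  have hrow (j : ι) : ∃ i, A j i ≠ 0 := by
    by_contra! h₀
    have := congrFun (congrFun hAC j) j
    simp [Matrix.mul_apply, h₀] at this
  choose s hs using hcol
  have hsurj : Function.Surjective s := fun j => by
    obtain ⟨i, hi⟩ := hrow j
    exact ⟨i, hb ((hcomm _ _ (hs i)).symm.trans (hcomm _ _ hi))⟩
  exact ⟨.ofBijective s (Finite.surjective_iff_bijective.mp hsurj), fun i => hcomm _ _ (hs i)⟩

/-- Identifiability of the parameters of a hidden Markov model from the values of the law of three
observations, for abstract emission functions normalized at a point `u`. -/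
theorem hmm_parameters_unique {X ι : Type*} [Fintype ι] [DecidableEq ι]
    {Q Q' : Matrix ι ι ℝ} (hQrow : ∀ i, ∑ j, Q i j = 1) (hQ : Q.det ≠ 0)
    {p p' : ι → ℝ} (hp : ∀ j, 0 < p j) (hstat : ∀ i, ∑ j, p j * Q j i = p i)
    (hQ'row : ∀ i, ∑ j, Q' i j = 1) (hstat' : ∀ i, ∑ j, p' j * Q' j i = p' i)
    {m m' : ι → X → ℝ} (hm : LinearIndependent ℝ m) {u : X}
    (hmu : ∀ i, m i u = 1) (hmu' : ∀ i, m' i u = 1)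
    (h : ∀ x y z,
      ∑ i, (∑ j, p j * Q j i * m j x) * m i y * (∑ j, Q i j * m j z) =
      ∑ i, (∑ j, p' j * Q' j i * m' j x) * m' i y * (∑ j, Q' i j * m' j z)) :
    ∃ σ : Equiv.Perm ι, (∀ i, m' i = m (σ i)) ∧ (∀ i j, Q' i j = Q (σ i) (σ j)) ∧
      ∀ i, p' i = p (σ i) := by
  have ha : LinearIndependent ℝ fun i x => ∑ j, p j * Q j i * m j x := by
    have hM : (Matrix.diagonal p * Q).transpose.det ≠ 0 := by
      rw [Matrix.det_transpose, Matrix.det_mul, Matrix.det_diagonal]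
      exact mul_ne_zero (prod_ne_zero_iff.mpr fun j _ => (hp j).ne') hQ
    have heq : (fun i x => ∑ j, p j * Q j i * m j x) = fun i => ∑ j, (Matrix.diagonal p * Q).transpose i j • m j := by
      ext i x
      simp [Finset.sum_apply, Matrix.diagonal_mul]
    rw [heq]
    exact hm.sum_smul_of_det_ne_zero hM
  have hc : LinearIndependent ℝ fun i z => ∑ j, Q i j * m j z := by
    have heq : (fun i z => ∑ j, Q i j * m j z) = fun i => ∑ j, Q i j • m j := by
      ext i z
      simp [Finset.sum_apply]
    rw [heq]
    exact hm.sum_smul_of_det_ne_zero hQ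
  obtain ⟨σ, hσ⟩ := exists_perm_middle_factor_eq ha hm.injective hc hmu hmu' h
  have hac (x z : X) (i : ι) : (∑ j, p j * Q j (σ i) * m j x) * (∑ j, Q (σ i) j * m j z) =
      (∑ j, p' j * Q' j i * m' j x) * (∑ j, Q' i j * m' j z) := by
    rw [← sub_eq_zero]
    refine Fintype.linearIndependent_iff.mp (hm.comp σ σ.injective) (fun i =>
      (∑ j, p j * Q j (σ i) * m j x) * (∑ j, Q (σ i) j * m j z) -
      (∑ j, p' j * Q' j i * m' j x) * (∑ j, Q' i j * m' j z)) ?_ i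
    ext y
    have hxyz := h x y z
    rw [← Equiv.sum_comp σ, ← sub_eq_zero, ← sum_sub_distrib] at hxyz
    rw [Finset.sum_apply, Pi.zero_apply, ← hxyz]
    refine sum_congr rfl fun l _ => ?_
    simp only [Function.comp_apply, Pi.smul_apply, smul_eq_mul, hσ]
    ring
  have hpσ (i : ι) : p' i = p (σ i) := by
    simpa [hmu, hmu', hstat, hstat', hQrow, hQ'row] using (hac u u i).symm
  refine ⟨σ, hσ, fun i j => ?_, hpσ⟩
  rw [← sub_eq_zero]
  refine Fintype.linearIndependent_iff.mp (hm.comp σ σ.injective)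
    (fun j => Q' i j - Q (σ i) (σ j)) ?_ j
  ext z
  have hz := hac u z i
  simp only [hmu, hmu', mul_one, hstat, hstat'] at hz
  rw [hpσ] at hz
  replace hz := mul_left_cancel₀ (hp (σ i)).ne' hz
  rw [← Equiv.sum_comp σ, eq_comm, ← sub_eq_zero, ← sum_sub_distrib] at hz
  rw [Finset.sum_apply, Pi.zero_apply, ← hz]
  refine sum_congr rfl fun l _ => ?_
  simp only [Function.comp_apply, Pi.smul_apply, smul_eq_mul, hσ]
  ring

/-- The value of a nonnegative combination of finite measures on a set. -/
theorem measureReal_sum_ofReal_smul {α ι : Type*} [MeasurableSpace α] [Fintype ι]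
    (μ : ι → Measure α) [∀ i, IsFiniteMeasure (μ i)] {w : ι → ℝ} (hw : ∀ i, 0 ≤ w i) (s : Set α) :
    (∑ i, ENNReal.ofReal (w i) • μ i).real s = ∑ i, w i * (μ i).real s := by
  rw [measureReal_def, Measure.finsetSum_apply, ENNReal.toReal_sum]
  · simp [measureReal_def, ENNReal.toReal_mul, ENNReal.toReal_ofReal, hw]
  · exact fun i _ => by simp [ENNReal.mul_ne_top]

/-- The value of a hidden Markov model's law of three observations on a measurable box. -/
theorem measureReal_hmm_box {α ι : Type*} [MeasurableSpace α] [Fintype ι]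
    (μ : ι → Measure α) [∀ i, IsProbabilityMeasure (μ i)]
    {Q : Matrix ι ι ℝ} (hQ : ∀ i j, 0 ≤ Q i j) {p : ι → ℝ} (hp : ∀ j, 0 ≤ p j) (s t r : Set α) :
    (∑ i, ((∑ j, ENNReal.ofReal (p j * Q j i) • μ j).prod
      ((μ i).prod (∑ j, ENNReal.ofReal (Q i j) • μ j)))).real (s ×ˢ t ×ˢ r) =
    ∑ i, (∑ j, p j * Q j i * (μ j).real s) * (μ i).real t * (∑ j, Q i j * (μ j).real r) := by
  have hfin (w : ι → ℝ) : IsFiniteMeasure (∑ j, ENNReal.ofReal (w j) • μ j) :=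
    ⟨by simp [Measure.finsetSum_apply, ENNReal.sum_lt_top]⟩
  rw [measureReal_def, Measure.finsetSum_apply, ENNReal.toReal_sum]
  · refine sum_congr rfl fun i _ => ?_
    rw [← measureReal_def, measureReal_prod_prod, measureReal_prod_prod,
      measureReal_sum_ofReal_smul μ fun j => mul_nonneg (hp j) (hQ j i),
      measureReal_sum_ofReal_smul μ (hQ i), mul_assoc]
  · exact fun i _ => measure_ne_top _ _

/-- Theorem 1 of the paper: identifiability of nonparametric HMMs from the law of
three consecutive observations, up to label swapping. -/
theorem hmm_identifiability
    (k : ℕ) (hk : 1 ≤ k)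
    -- the true parameters
    (Q : Matrix (Fin k) (Fin k) ℝ)
    (hQnn : ∀ i j, 0 ≤ Q i j) (hQrow : ∀ i, ∑ j, Q i j = 1)
    (hQrank : Q.det ≠ 0)
    (π : Fin k → ℝ) (hπpos : ∀ j, 0 < π j) (hπsum : ∑ j, π j = 1)
    (hπstat : ∀ i, ∑ j, π j * Q j i = π i)
    (μ : Fin k → Measure ℝ) [∀ i, IsProbabilityMeasure (μ i)]
    (hμli : LinearIndependent ℝ fun i => (μ i).toSignedMeasure)
    -- the alternative parameters
    (Q' : Matrix (Fin k) (Fin k) ℝ)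
    (hQ'nn : ∀ i j, 0 ≤ Q' i j) (hQ'row : ∀ i, ∑ j, Q' i j = 1)
    (π' : Fin k → ℝ) (hπ'nn : ∀ j, 0 ≤ π' j) (hπ'sum : ∑ j, π' j = 1)
    (hπ'stat : ∀ i, ∑ j, π' j * Q' j i = π' i)
    (μ' : Fin k → Measure ℝ) [∀ i, IsProbabilityMeasure (μ' i)]
    -- equality of the laws of three consecutive observations
    (heq :
      (∑ i, ((∑ j, ENNReal.ofReal (π j * Q j i) • μ j).prod
        ((μ i).prod (∑ j, ENNReal.ofReal (Q i j) • μ j)))) =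
      (∑ i, ((∑ j, ENNReal.ofReal (π' j * Q' j i) • μ' j).prod
        ((μ' i).prod (∑ j, ENNReal.ofReal (Q' i j) • μ' j))))) :
    ∃ σ : Equiv.Perm (Fin k),
      (∀ i, μ' i = μ (σ i)) ∧
      (∀ i j, Q' i j = Q (σ i) (σ j)) ∧
      (∀ i, π' i = π (σ i)) := by
  let m (ν : Fin k → Measure ℝ) (i : Fin k) (s : {s : Set ℝ // MeasurableSet s}) : ℝ := (ν i).real s
  have hm : LinearIndependent ℝ (m μ) := by
    rw [Fintype.linearIndependent_iff] at hμli ⊢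
    refine fun g hg => hμli g (VectorMeasure.ext fun s hs => ?_)
    have hgs := congrFun hg ⟨s, hs⟩
    have hsum : (∑ i, g i • (μ i).toSignedMeasure) s = ∑ i, g i * (μ i).real s := by
      rw [← FunLike.coeAddMonoidHom_apply, map_sum, Finset.sum_apply]
      simp [Measure.toSignedMeasure_apply_measurable hs]
    simpa [m, hsum] using hgs
  obtain ⟨σ, hσ, hQσ, hπσ⟩ := hmm_parameters_unique (m := m μ) (m' := m μ') (u := ⟨.univ, .univ⟩)
    hQrow hQrank hπpos hπstat hQ'row hπ'stat hm (by simp [m]) (by simp [m]) fun s t r => by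
      simp only [m]
      rw [← measureReal_hmm_box μ hQnn fun j => (hπpos j).le, heq,
        measureReal_hmm_box μ' hQ'nn hπ'nn]
  refine ⟨σ, fun i => Measure.ext fun s hs => ?_, hQσ, hπσ⟩
  exact (measureReal_eq_measureReal_iff).mp (congrFun (hσ i) ⟨s, hs⟩)
end

section
/- Let V be a real vector space, k ≥ 1, and let δ, φ_1,…,φ_k ∈ V be such that the family (δ, φ_1,…,φ_k) of k+1 vectors is linearly independent. Let q_1,…,q_k ∈ [0,1] with at most one index j satisfying q_j = 1. Then the vectors μ_j = q_j δ + (1 − q_j) φ_j, j = 1,…,k, are linearly independent in V. -/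
open Finset

/-- Zero-inflated emission distributions `μ j = q j • δ + (1 - q j) • φ j` are
linearly independent provided `(δ, φ₁, …, φ_k)` is linearly independent and at
most one zero-inflation weight `q j` equals one. -/
theorem zero_inflated_linearIndependent
    {V : Type*} [AddCommGroup V] [Module ℝ V]
    (k : ℕ) (hk : 1 ≤ k)
    (δ : V) (φ : Fin k → V)
    (hli : LinearIndependent ℝ (Fin.cons δ φ : Fin (k + 1) → V))
    (q : Fin k → ℝ) (hq0 : ∀ j, 0 ≤ q j) (hq1 : ∀ j, q j ≤ 1)
    (hatmost : ∀ j j', q j = 1 → q j' = 1 → j = j')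
    (μ : Fin k → V) (hμdef : ∀ j, μ j = q j • δ + (1 - q j) • φ j) :
    LinearIndependent ℝ μ := by
  rw [Fintype.linearIndependent_iff] at hli ⊢
  intro g hg
  have hcoeff := hli (Fin.cons (∑ j, g j * q j) fun j => g j * (1 - q j)) (by
    rw [← hg, Fin.sum_univ_succ]
    simp only [Fin.cons_zero, Fin.cons_succ, hμdef, smul_add, smul_smul,
      Finset.sum_add_distrib, Finset.sum_smul])
  have hδ : ∑ j, g j * q j = 0 := by simpa using hcoeff 0
  have hφ : ∀ j, q j ≠ 1 → g j = 0 := fun j hj => by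
    have h : g j * (1 - q j) = 0 := by simpa only [Fin.cons_succ] using hcoeff j.succ
    exact (mul_eq_zero.mp h).resolve_right (sub_ne_zero.mpr hj.symm)
  intro i
  by_cases hi : q i = 1
  · rw [Finset.sum_eq_single_of_mem i (Finset.mem_univ i)
      fun j _ hji => by rw [hφ j fun hj => hji (hatmost j i hj hi), zero_mul]] at hδ
    simpa [hi] using hδ
  · exact hφ i hi
end

section
/- Let I, U, J be nonempty finite index sets. Let τ = (τ_{ij})_{i∈I, j∈J} be nonnegative reals, let R = (R_{iu})_{i∈I, u∈U} be strictly positive reals, and let P^ℓ = (p^ℓ_{uj})_{u∈U, j∈J} satisfy p^ℓ_{uj} > 0 and Σ_{u∈U} p^ℓ_{uj} = 1 for every j. Assume Σ_{i∈I} τ_{ij} > 0 for every j ∈ J. Define γ^ℓ_{iuj} = p^ℓ_{uj} R_{iu} / Σ_{v∈U} p^ℓ_{vj} R_{iv} and p^{ℓ+1}_{uj} = (Σ_{i∈I} τ_{ij} γ^ℓ_{iuj}) / (Σ_{i∈I} Σ_{v∈U} τ_{ij} γ^ℓ_{ivj}). Define G(P) = Σ_{i∈I} Σ_{j∈J} τ_{ij}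 log(Σ_{u∈U} p_{uj} R_{iu}). Then G(P^{ℓ+1}) ≥ G(P^ℓ). -/
open Finset

/-- **Gibbs' inequality** for positive weights with the same total mass. -/
theorem sum_mul_log_div_nonneg {U : Type*} [Fintype U] {p q : U → ℝ}
    (hp : ∀ u, 0 < p u) (hq : ∀ u, 0 < q u) (h : ∑ u, p u = ∑ u, q u) :
    0 ≤ ∑ u, q u * Real.log (q u / p u) := by
  have key : ∑ u, (q u - p u) ≤ ∑ u, q u * Real.log (q u / p u) := by
    refine sum_le_sum fun u _ => ?_
    calc q u - p u = q u * (1 - (q u / p u)⁻¹) := by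
          have := (hp u).ne'
          have := (hq u).ne'
          field_simp
      _ ≤ q u * Real.log (q u / p u) :=
          mul_le_mul_of_nonneg_left (Real.one_sub_inv_le_log_of_pos (div_pos (hq u) (hp u)))
            (hq u).le
  rwa [sum_sub_distrib, h, sub_self] at key

/-- The minorization underlying the EM algorithm for mixtures: the log-likelihood ratio of two
weight vectors dominates the posterior mean of the log-ratio of the weights. -/
theorem sum_posterior_mul_log_div_le {U : Type*} [Fintype U] [Nonempty U] {p q r : U → ℝ}
    (hp : ∀ u, 0 < p u) (hq : ∀ u, 0 < q u) (hr : ∀ u, 0 < r u) :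
    ∑ u, (p u * r u / ∑ v, p v * r v) * Real.log (q u / p u) ≤
      Real.log (∑ u, q u * r u) - Real.log (∑ u, p u * r u) := by
  have hS : 0 < ∑ v, p v * r v := sum_pos (fun v _ => mul_pos (hp v) (hr v)) univ_nonempty
  have hS' : 0 < ∑ v, q v * r v := sum_pos (fun v _ => mul_pos (hq v) (hr v)) univ_nonempty
  have jensen := strictConcaveOn_log_Ioi.concaveOn.le_map_sum (t := univ)
    (w := fun u => p u * r u / ∑ v, p v * r v) (p := fun u => q u / p u)
    (fun u _ => (div_pos (mul_pos (hp u) (hr u)) hS).le)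
    (by rw [← sum_div, div_self hS.ne'])
    (fun u _ => div_pos (hq u) (hp u))
  simp only [smul_eq_mul] at jensen
  rw [← Real.log_div hS'.ne' hS.ne']
  refine jensen.trans_eq (congrArg Real.log ?_)
  rw [sum_div]
  refine sum_congr rfl fun u _ => ?_
  have := (hp u).ne'
  field_simp

/-- One EM update of the weights of a mixture with fixed components, for observations weighted
by `τ`, does not decrease the weighted log-likelihood. -/
theorem sum_mul_log_le_of_em_update {I U : Type*} [Fintype I] [Fintype U] [Nonempty U]
    {τ : I → ℝ} (hτ : ∀ i, 0 ≤ τ i) (hτpos : 0 < ∑ i, τ i)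
    {R : I → U → ℝ} (hR : ∀ i u, 0 < R i u)
    {p q : U → ℝ} (hp : ∀ u, 0 < p u) (hp1 : ∑ u, p u = 1)
    (hq : ∀ u, q u = (∑ i, τ i * (p u * R i u / ∑ v, p v * R i v)) / ∑ i, τ i) :
    ∑ i, τ i * Real.log (∑ u, p u * R i u) ≤ ∑ i, τ i * Real.log (∑ u, q u * R i u) := by
  have hS : ∀ i, 0 < ∑ v, p v * R i v := fun i =>
    sum_pos (fun v _ => mul_pos (hp v) (hR i v)) univ_nonempty
  have hγ : ∀ i u, 0 < p u * R i u / ∑ v, p v * R i v := fun i u =>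
    div_pos (mul_pos (hp u) (hR i u)) (hS i)
  have hqpos : ∀ u, 0 < q u := by
    intro u
    obtain ⟨i, hi, hi0⟩ := exists_lt_of_sum_lt (s := univ) (f := fun _ : I => (0 : ℝ)) (g := τ)
      (by simpa using hτpos)
    rw [hq]
    exact div_pos (sum_pos' (fun i _ => mul_nonneg (hτ i) (hγ i u).le)
      ⟨i, hi, mul_pos hi0 (hγ i u)⟩) hτpos
  have hq1 : ∑ u, q u = 1 := by
    simp_rw [hq]
    rw [← sum_div, sum_comm, div_eq_one_iff_eq hτpos.ne']
    refine sum_congr rfl fun i _ => ?_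
    rw [← mul_sum, ← sum_div, div_self (hS i).ne', mul_one]
  rw [← sub_nonneg, ← sum_sub_distrib]
  calc 0 ≤ (∑ i, τ i) * ∑ u, q u * Real.log (q u / p u) :=
        mul_nonneg hτpos.le (sum_mul_log_div_nonneg hp hqpos (hp1.trans hq1.symm))
    _ = ∑ u, (∑ i, τ i * (p u * R i u / ∑ v, p v * R i v)) * Real.log (q u / p u) := by
        rw [mul_sum]
        refine sum_congr rfl fun u _ => ?_
        rw [← mul_assoc, mul_comm (∑ i, τ i), (eq_div_iff hτpos.ne').mp (hq u)]
    _ = ∑ i, τ i * ∑ u, (p u * R i u / ∑ v, p v * R i v) * Real.log (q u / p u) := by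
        simp_rw [sum_mul, mul_sum, mul_assoc]
        exact sum_comm
    _ ≤ ∑ i, (τ i * Real.log (∑ u, q u * R i u) - τ i * Real.log (∑ u, p u * R i u)) := by
        refine sum_le_sum fun i _ => ?_
        rw [← mul_sub]
        exact mul_le_mul_of_nonneg_left (sum_posterior_mul_log_div_le hp hqpos (hR i)) (hτ i)

/-- Proposition 2 of the paper: the GEM recursion on the kernel weights
increases the objective `G(P) = ∑ i j, τ i j * log (∑ u, p u j * R i u)`. -/
theorem gem_recursion_increases
    {I U J : Type*} [Fintype I] [Fintype U] [Fintype J]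
    [Nonempty I] [Nonempty U] [Nonempty J]
    (τ : I → J → ℝ) (hτ : ∀ i j, 0 ≤ τ i j)
    (R : I → U → ℝ) (hR : ∀ i u, 0 < R i u)
    (p : U → J → ℝ) (hp : ∀ u j, 0 < p u j) (hp1 : ∀ j, ∑ u, p u j = 1)
    (hτpos : ∀ j, 0 < ∑ i, τ i j)
    (γ : I → U → J → ℝ)
    (hγ : ∀ i u j, γ i u j = p u j * R i u / ∑ v, p v j * R i v)
    (p' : U → J → ℝ)
    (hp' : ∀ u j, p' u j = (∑ i, τ i j * γ i u j) / (∑ i, ∑ v, τ i j * γ i v j))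
    (G : (U → J → ℝ) → ℝ)
    (hG : ∀ P : U → J → ℝ, G P = ∑ i, ∑ j, τ i j * Real.log (∑ u, P u j * R i u)) :
    G p ≤ G p' := by
  rw [hG, hG, sum_comm, sum_comm (f := fun i j => τ i j * Real.log (∑ u, p' u j * R i u))]
  refine sum_le_sum fun j _ => ?_
  refine sum_mul_log_le_of_em_update (fun i => hτ i j) (hτpos j) hR (fun u => hp u j) (hp1 j)
    fun u => ?_
  have hden : ∑ i, ∑ v, τ i j * γ i v j = ∑ i, τ i j := by
    refine sum_congr rfl fun i _ => ?_
    have hS : 0 < ∑ v, p v j * R i v :=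
      sum_pos (fun v _ => mul_pos (hp v j) (hR i v)) univ_nonempty
    simp_rw [← mul_sum, hγ]
    rw [← sum_div, div_self hS.ne', mul_one]
  rw [hp', hden]
  simp_rw [hγ]
end
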